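/- For strong compositions α and β, the product of fundamental quasisymmetric polynomials in n variables satisfies F_α · F_β = ∑_γ c_{α,β}^γ F_γ, where c_{α,β}^γ is the multiplicity of γ in the shuffle product α ⧢ β. -/

import Mathlib

open MvPolynomial

/-- The monomial `x^b` in `n` variables. -/
noncomputable def xpow (n : ℕ) (b : Fin n → ℕ) : MvPolynomial (Fin n) ℤ :=
  ∏ i, X i ^ b i

/-- The positive part of a weak composition: delete all zero entries. -/
def posPart {n : ℕ} (b : Fin n → ℕ) : List ℕ :=
  (List.ofFn b).filter (fun x => x ≠ 0)

/-- `β` refines `α`: `α` is obtained by summing consecutive (nonempty) blocks of `β`. -/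
def Refines (β α : List ℕ) : Prop :=
  ∃ L : List (List ℕ), L.flatten = β ∧ L.map List.sum = α ∧ ∀ l ∈ L, l ≠ []

/-- The fundamental quasisymmetric polynomial `F_α(x_1, …, x_n)`. -/
noncomputable def Fq (n : ℕ) (α : List ℕ) : MvPolynomial (Fin n) ℤ :=
  ∑ᶠ (b : Fin n → ℕ) (_ : Refines (posPart b) α), xpow n b

/-- The odd-letter word `A` associated to `α`: `α_1` copies of `2ℓ(α)-1`, then `α_2`
copies of `2ℓ(α)-3`, …, then `α_{ℓ(α)}` copies of `1`. -/
def wordA (α : List ℕ) : List ℕ :=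
  ((List.range α.length).map
    (fun i => List.replicate (α.getD i 0) (2 * α.length - 1 - 2 * i))).flatten

/-- The even-letter word `B` associated to `β`: `β_1` copies of `2ℓ(β)`, then `β_2`
copies of `2ℓ(β)-2`, …, then `β_{ℓ(β)}` copies of `2`. -/
def wordB (β : List ℕ) : List ℕ :=
  ((List.range β.length).map
    (fun i => List.replicate (β.getD i 0) (2 * β.length - 2 * i))).flatten

/-- `C` is a shuffle of the odd word `A` and the even word `B`: its subword of odd letters
is `A` and its subword of even letters is `B`. -/
def IsShuffle (A B C : List ℕ) : Prop :=
  C.filter (fun x => x % 2 == 1) = A ∧ C.filter (fun x => x % 2 == 0) = B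

/-- The descent composition of a word: the lengths of its maximal weakly increasing runs. -/
def descComp : List ℕ → List ℕ
  | [] => []
  | [_] => [1]
  | x :: y :: rest =>
      if x ≤ y then
        match descComp (y :: rest) with
        | [] => [1]
        | c :: cs => (c + 1) :: cs
      else 1 :: descComp (y :: rest)

/-- The multiplicity of `γ` in the shuffle product `α ⧢ β`: the number of shuffles `C` of
the words `A`, `B` with descent composition `γ`. -/
noncomputable def shuffleMult (α β γ : List ℕ) : ℕ :=
  Nat.card {C : List ℕ // IsShuffle (wordA α) (wordB β) C ∧ descComp C = γ}

/-- `w` splits into consecutive weakly increasing chunks with lengths `bs`. -/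
def Chunks : List ℕ → List ℕ → Prop
  | [], w => w = []
  | b :: bs, w => b ≤ w.length ∧ (w.take b).Pairwise (· ≤ ·) ∧ Chunks bs (w.drop b)

theorem chunks_filter (bs w : List ℕ) :
    Chunks (bs.filter (fun x => x ≠ 0)) w ↔ Chunks bs w := by
  induction bs generalizing w with
  | nil => simp
  | cons b bs ih =>
    by_cases hb : b = 0
    · subst hb
      simpa [Chunks] using ih w
    · simp [hb, Chunks] at ih ⊢
      simp [ih]

theorem chunks_sum (bs w : List ℕ) (h : Chunks bs w) : bs.sum = w.length := by
  induction bs generalizing w with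
  | nil => simp_all [Chunks]
  | cons b bs ih =>
    obtain ⟨h1, _, h3⟩ := h
    have := ih _ h3
    simp at this ⊢
    omega

theorem refines_nil_right (c : List ℕ) : Refines c [] ↔ c = [] := by
  constructor
  · rintro ⟨L, h1, h2, h3⟩
    simp at h2
    subst h2
    simpa using h1.symm
  · rintro rfl
    exact ⟨[], by simp⟩

theorem refines_nil_left (γ : List ℕ) : Refines [] γ ↔ γ = [] := by
  constructor
  · rintro ⟨L, h1, h2, h3⟩
    cases L with
    | nil => simpa using h2.symm
    | cons l L => simp at h1 h3; exact absurd h1.1 h3.1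
  · rintro rfl
    exact ⟨[], by simp⟩

theorem refines_cons_cons (a g : ℕ) (c γ : List ℕ) :
    Refines (a :: c) (g :: γ) ↔
      (a = g ∧ Refines c γ) ∨ (a ≤ g ∧ Refines c ((g - a) :: γ)) := by
  constructor
  · rintro ⟨L, h1, h2, h3⟩
    cases L with
    | nil => simp at h2
    | cons l L =>
      simp at h2 h3
      cases l with
      | nil => simp at h3
      | cons x l =>
        simp at h1 h2
        obtain ⟨rfl, h1⟩ := h1
        cases l with
        | nil =>
          left
          exact ⟨by simpa using h2.1, L, by simpa using h1, h2.2, h3.2⟩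
        | cons y l =>
          right
          refine ⟨by omega, (y :: l) :: L, by simpa using h1, ?_, ?_⟩
          · simp at h2 ⊢
            exact ⟨by omega, h2.2⟩
          · simpa using h3
  · rintro (⟨rfl, L, h1, h2, h3⟩ | ⟨hle, L, h1, h2, h3⟩)
    · exact ⟨[a] :: L, by simp [h1], by simp [h2], by simpa using h3⟩
    · cases L with
      | nil => simp at h2
      | cons l L =>
        simp at h1 h2 h3
        refine ⟨(a :: l) :: L, by simp [h1], ?_, by simpa using h3.2⟩
        simp [h2]; omega

theorem refines_nil_cons (g : ℕ) (γ : List ℕ) : ¬ Refines [] (g :: γ) := by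
  simp [refines_nil_left]

theorem refines_zero (c γ : List ℕ) (hc : ∀ x ∈ c, 0 < x) : ¬ Refines c (0 :: γ) := by
  cases c with
  | nil => exact refines_nil_cons _ _
  | cons a c =>
    have := hc a (by simp)
    rw [refines_cons_cons]
    omega

theorem descComp_ne_nil (x : ℕ) (w : List ℕ) : ∃ d ds, descComp (x :: w) = (d + 1) :: ds := by
  induction w generalizing x with
  | nil => exact ⟨0, [], rfl⟩
  | cons y w ih =>
    obtain ⟨d, ds, h⟩ := ih y
    rw [descComp]
    split_ifs
    · rw [h]; exact ⟨_, _, rfl⟩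
    · exact ⟨0, _, rfl⟩

theorem descComp_le (x y : ℕ) (w : List ℕ) (h : x ≤ y) (d : ℕ) (ds : List ℕ)
    (hd : descComp (y :: w) = d :: ds) : descComp (x :: y :: w) = (d + 1) :: ds := by
  rw [descComp, if_pos h, hd]

theorem descComp_gt (x y : ℕ) (w : List ℕ) (h : y < x) :
    descComp (x :: y :: w) = 1 :: descComp (y :: w) := by
  rw [descComp, if_neg (by omega)]

theorem descComp_pos (w : List ℕ) : ∀ x ∈ descComp w, 0 < x := by
  induction w with
  | nil => simp [descComp]
  | cons x w ih =>
    cases w with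
    | nil => simp [descComp]
    | cons y w =>
      obtain ⟨d, ds, h⟩ := descComp_ne_nil y w
      rcases le_or_gt x y with hxy | hxy
      · rw [descComp_le x y w hxy _ _ h]
        rw [h] at ih
        simp at ih ⊢
        exact ih
      · rw [descComp_gt x y w hxy]
        simpa using ih

theorem refines_iff_chunks (w : List ℕ) : ∀ bs : List ℕ, (∀ x ∈ bs, 0 < x) →
    (Refines bs (descComp w) ↔ Chunks bs w) := by
  induction w with
  | nil =>
    intro bs hbs
    rw [descComp, refines_nil_right]
    cases bs with
    | nil => simp [Chunks]
    | cons b bs =>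
      have := hbs b (by simp)
      simp [Chunks]; omega
  | cons x w ih =>
    intro bs hbs
    cases bs with
    | nil =>
      obtain ⟨d, ds, h⟩ := descComp_ne_nil x w
      rw [h, refines_nil_left]
      simp [Chunks]
    | cons a c =>
      have hc : ∀ x ∈ c, 0 < x := fun x hx => hbs x (by simp [hx])
      have ha := hbs a (by simp)
      match a, ha with
      | 1, _ =>
        have hG : Chunks (1 :: c) (x :: w) ↔ Chunks c w := by simp [Chunks]
        rw [hG, ← ih c hc]
        cases w with
        | nil =>
          have := refines_zero c [] hc
          simp [descComp, refines_cons_cons, this]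
        | cons y w =>
          obtain ⟨d, ds, h⟩ := descComp_ne_nil y w
          rcases le_or_gt x y with hxy | hxy
          · rw [descComp_le x y w hxy _ _ h, h, refines_cons_cons]
            simp
          · rw [descComp_gt x y w hxy, refines_cons_cons]
            have := refines_zero c (descComp (y :: w)) hc
            simp [this]
      | k + 2, _ =>
        cases w with
        | nil => simp [descComp, refines_cons_cons, Chunks]
        | cons y w =>
          obtain ⟨d, ds, h⟩ := descComp_ne_nil y w
          rcases le_or_gt x y with hxy | hxy
          · have hG : Chunks ((k + 2) :: c) (x :: y :: w) ↔ Chunks ((k + 1) :: c) (y :: w) := by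
              simp only [Chunks, List.take_succ_cons, List.drop_succ_cons, List.length_cons,
                List.pairwise_cons, List.mem_cons]
              constructor
              · rintro ⟨h1, h2, h3⟩
                exact ⟨by omega, h2.2, h3⟩
              · rintro ⟨h1, h2, h3⟩
                refine ⟨by omega, ⟨?_, h2⟩, h3⟩
                rintro z (rfl | hz)
                · exact hxy
                · exact hxy.trans (h2.1 z hz)
            rw [hG, ← ih ((k + 1) :: c) (by simpa using hc), descComp_le x y w hxy _ _ h, h,
              refines_cons_cons, refines_cons_cons]
            simp
          · rw [descComp_gt x y w hxy, refines_cons_cons]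
            simp [Chunks]
            omega

theorem refines_posPart {n : ℕ} (b : Fin n → ℕ) (w : List ℕ) :
    Refines (posPart b) (descComp w) ↔ Chunks (List.ofFn b) w := by
  have hpos : ∀ x ∈ (List.ofFn b).filter (fun x => x ≠ 0), 0 < x := by
    intro x hx
    have := (List.mem_filter.1 hx).2
    simp at this
    omega
  exact (refines_iff_chunks w _ hpos).trans (chunks_filter _ w)

theorem descComp_replicate (a x : ℕ) (w : List ℕ) (hw : ∀ y ∈ w, y < x) :
    descComp (List.replicate (a + 1) x ++ w) = (a + 1) :: descComp w := by
  induction a with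
  | zero =>
    cases w with
    | nil => simp [descComp]
    | cons y w => simpa using descComp_gt x y w (hw y (by simp))
  | succ a ih =>
    exact descComp_le x x _ le_rfl _ _ ih

theorem wordA_cons (a : ℕ) (α : List ℕ) :
    wordA (a :: α) = List.replicate a (2 * α.length + 1) ++ wordA α := by
  simp only [wordA, List.length_cons, List.range_succ_eq_map, List.map_cons, List.map_map,
    List.flatten_cons]
  congr 3
  funext i
  simp
  congr 1
  omega

theorem wordB_cons (a : ℕ) (α : List ℕ) :
    wordB (a :: α) = List.replicate a (2 * α.length + 2) ++ wordB α := by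
  simp only [wordB, List.length_cons, List.range_succ_eq_map, List.map_cons, List.map_map,
    List.flatten_cons]
  congr 3
  funext i
  simp
  congr 1
  omega

theorem wordA_mem (α : List ℕ) : ∀ x ∈ wordA α, x % 2 = 1 ∧ x < 2 * α.length + 1 := by
  induction α with
  | nil => simp [wordA]
  | cons a α ih =>
    intro x hx
    simp only [wordA_cons, List.mem_append, List.mem_replicate] at hx
    simp only [List.length_cons]
    rcases hx with ⟨_, rfl⟩ | hx
    · omega
    · have := ih x hx; omega

theorem wordB_mem (α : List ℕ) : ∀ x ∈ wordB α, x % 2 = 0 ∧ x < 2 * α.length + 2 := by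
  induction α with
  | nil => simp [wordB]
  | cons a α ih =>
    intro x hx
    simp only [wordB_cons, List.mem_append, List.mem_replicate] at hx
    simp only [List.length_cons]
    rcases hx with ⟨_, rfl⟩ | hx
    · omega
    · have := ih x hx; omega

theorem descComp_wordA (α : List ℕ) (hα : ∀ x ∈ α, 0 < x) : descComp (wordA α) = α := by
  induction α with
  | nil => simp [wordA, descComp]
  | cons a α ih =>
    obtain ⟨k, rfl⟩ := Nat.exists_eq_succ_of_ne_zero (hα a (by simp)).ne'
    rw [wordA_cons, descComp_replicate _ _ _ (fun y hy => (wordA_mem α y hy).2),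
      ih (fun x hx => hα x (by simp [hx]))]

theorem descComp_wordB (α : List ℕ) (hα : ∀ x ∈ α, 0 < x) : descComp (wordB α) = α := by
  induction α with
  | nil => simp [wordB, descComp]
  | cons a α ih =>
    obtain ⟨k, rfl⟩ := Nat.exists_eq_succ_of_ne_zero (hα a (by simp)).ne'
    rw [wordB_cons, descComp_replicate _ _ _ (fun y hy => (wordB_mem α y hy).2),
      ih (fun x hx => hα x (by simp [hx]))]

/-- Lexicographic order on (index, letter) pairs. -/
def LexR {n : ℕ} (p q : Fin n × ℕ) : Prop := p.1 < q.1 ∨ (p.1 = q.1 ∧ p.2 ≤ q.2)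

instance {n : ℕ} : DecidableRel (LexR (n := n)) := fun p q => by unfold LexR; infer_instance

instance {n : ℕ} : IsTrans (Fin n × ℕ) LexR := ⟨fun a b c => by unfold LexR; omega⟩

instance {n : ℕ} : Std.Total (LexR (n := n)) := ⟨fun a b => by unfold LexR; omega⟩

instance {n : ℕ} : Std.Antisymm (LexR (n := n)) := ⟨fun a b h1 h2 => by
  unfold LexR at h1 h2
  apply Prod.ext
  · omega
  · omega⟩

/-- Sorted lists of (index, letter) pairs whose word of letters is `w`. -/
def SL (n : ℕ) (w : List ℕ) : Set (List (Fin n × ℕ)) :=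
  {L | L.Pairwise LexR ∧ L.map Prod.snd = w}

/-- The weight of a list of pairs. -/
noncomputable def wt {n : ℕ} (L : List (Fin n × ℕ)) : MvPolynomial (Fin n) ℤ :=
  (L.map (fun p => X p.1)).prod

/-- The index word of a weak composition, restricted to the index list `P`. -/
def expd {n : ℕ} (b : Fin n → ℕ) (P : List (Fin n)) : List (Fin n) :=
  P.flatMap (fun i => List.replicate (b i) i)

theorem mem_expd {n : ℕ} (b : Fin n → ℕ) (P : List (Fin n)) (i : Fin n)
    (h : i ∈ expd b P) : i ∈ P := by
  simp only [expd, List.mem_flatMap, List.mem_replicate] at h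
  obtain ⟨a, h1, _, rfl⟩ := h
  exact h1

theorem zip_replicate_sorted {n : ℕ} (i : Fin n) (w : List ℕ) :
    ((List.replicate w.length i).zip w).Pairwise LexR ↔ w.Pairwise (· ≤ ·) := by
  have : (List.replicate w.length i).zip w = w.map (fun x => (i, x)) := by
    induction w with
    | nil => simp
    | cons x w ih => simp [List.replicate_succ, ih]
  rw [this, List.pairwise_map]
  simp [LexR]

theorem chunks_iff_sorted {n : ℕ} (b : Fin n → ℕ) (P : List (Fin n)) (hP : P.Pairwise (· < ·))
    (w : List ℕ) :
    Chunks (P.map b) w ↔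
      (expd b P).length = w.length ∧ ((expd b P).zip w).Pairwise LexR := by
  induction P generalizing w with
  | nil => simp [Chunks, expd, eq_comm]
  | cons i P ih =>
    have hP' := List.pairwise_cons.1 hP
    have he : expd b (i :: P) = List.replicate (b i) i ++ expd b P := by simp [expd]
    rw [List.map_cons, Chunks, ih hP'.2, he]
    by_cases hle : b i ≤ w.length
    · have hlt : (w.take (b i)).length = b i := by simp [hle]
      have hz : (List.replicate (b i) i ++ expd b P).zip w =
          (List.replicate (b i) i).zip (w.take (b i)) ++ (expd b P).zip (w.drop (b i)) := by
        conv_lhs => rw [← List.take_append_drop (b i) w]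
        rw [List.zip_append (by simp [hle])]
      rw [hz, List.pairwise_append]
      have h1 := zip_replicate_sorted i (w.take (b i))
      rw [hlt] at h1
      rw [h1]
      have hcross : ∀ p ∈ (List.replicate (b i) i).zip (w.take (b i)),
          ∀ q ∈ (expd b P).zip (w.drop (b i)), LexR p q := by
        rintro ⟨p1, p2⟩ hp ⟨q1, q2⟩ hq
        have hp1 := (List.of_mem_zip hp).1
        have hq1 := mem_expd _ _ _ (List.of_mem_zip hq).1
        simp only [List.mem_replicate] at hp1
        left
        rw [hp1.2]
        exact hP'.1 _ hq1
      simp only [List.length_append, List.length_replicate, List.length_drop]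
      constructor
      · rintro ⟨_, h2, h3, h4⟩
        exact ⟨by omega, h2, h4, hcross⟩
      · rintro ⟨h2, h3, h4, _⟩
        exact ⟨hle, h3, by omega, h4⟩
    · simp only [List.length_append, List.length_replicate]
      constructor
      · rintro ⟨h, _⟩; exact absurd h hle
      · rintro ⟨h, _⟩; omega

theorem count_expd {n : ℕ} (b : Fin n → ℕ) (i : Fin n) :
    (expd b (List.finRange n)).count i = b i := by
  have : ∀ P : List (Fin n), P.Nodup → (expd b P).count i = if i ∈ P then b i else 0 := by
    intro P hP
    induction P with
    | nil => simp [expd]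
    | cons j P ih =>
      have he : expd b (j :: P) = List.replicate (b j) j ++ expd b P := by simp [expd]
      rw [List.nodup_cons] at hP
      rw [he, List.count_append, ih hP.2, List.count_replicate]
      by_cases hij : i = j
      · subst hij; simp [hP.1]
      · simp [hij, Ne.symm hij]
  simpa using this _ (List.nodup_finRange n)

theorem expd_sorted {n : ℕ} (b : Fin n → ℕ) (P : List (Fin n)) (hP : P.Pairwise (· < ·)) :
    (expd b P).Pairwise (· ≤ ·) := by
  induction P with
  | nil => simp [expd]
  | cons j P ih =>
    have he : expd b (j :: P) = List.replicate (b j) j ++ expd b P := by simp [expd]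
    rw [List.pairwise_cons] at hP
    rw [he, List.pairwise_append]
    refine ⟨by simp [List.pairwise_replicate], ih hP.2, ?_⟩
    intro x hx y hy
    simp only [List.mem_replicate] at hx
    rw [hx.2]
    exact (hP.1 _ (mem_expd _ _ _ hy)).le

theorem bij_SL (n : ℕ) (w : List ℕ) :
    Set.BijOn (fun b : Fin n → ℕ => (expd b (List.finRange n)).zip w)
      {b | Refines (posPart b) (descComp w)} (SL n w) := by
  have key : ∀ b : Fin n → ℕ, Refines (posPart b) (descComp w) ↔
      (expd b (List.finRange n)).length = w.length ∧
        ((expd b (List.finRange n)).zip w).Pairwise LexR := by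
    intro b
    rw [refines_posPart, ← chunks_iff_sorted b _ (List.pairwise_lt_finRange n), List.ofFn_eq_map]
  refine ⟨?_, ?_, ?_⟩
  · intro b hb
    obtain ⟨h1, h2⟩ := (key b).1 hb
    exact ⟨h2, List.map_snd_zip h1.ge⟩
  · intro b hb c hc h
    have hb' := (key b).1 hb
    have hc' := (key c).1 hc
    have h' := congrArg (List.map Prod.fst) h
    simp only [List.map_fst_zip hb'.1.le, List.map_fst_zip hc'.1.le] at h'
    funext i
    rw [← count_expd b i, h', count_expd]
  · rintro L ⟨h1, rfl⟩
    have hs : (L.map Prod.fst).Pairwise (· ≤ ·) := by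
      rw [List.pairwise_map]
      refine h1.imp ?_
      intro p q h
      unfold LexR at h
      omega
    have he : expd (fun i => (L.map Prod.fst).count i) (List.finRange n) = L.map Prod.fst := by
      apply List.Perm.eq_of_pairwise' (r := (· ≤ ·)) (expd_sorted _ _ (List.pairwise_lt_finRange n)) hs
      rw [List.perm_iff_count]
      intro i
      rw [count_expd]
    have hz : (L.map Prod.fst).zip (L.map Prod.snd) = L := by
      rw [List.zip_map']; simp
    refine ⟨fun i => (L.map Prod.fst).count i, ?_, ?_⟩
    · rw [Set.mem_setOf_eq, key, he, hz]
      exact ⟨by simp, h1⟩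
    · simp only [he, hz]

theorem wt_zip {n : ℕ} (b : Fin n → ℕ) (w : List ℕ) (h : Refines (posPart b) (descComp w)) :
    xpow n b = wt ((expd b (List.finRange n)).zip w) := by
  rw [refines_posPart, List.ofFn_eq_map, chunks_iff_sorted b _ (List.pairwise_lt_finRange n)] at h
  have h2 : wt ((expd b (List.finRange n)).zip w) = ((expd b (List.finRange n)).map X).prod := by
    rw [wt]
    conv_rhs => rw [← List.map_fst_zip h.1.le, List.map_map]
    rfl
  rw [h2, xpow, ← List.prod_ofFn, List.ofFn_eq_map]
  generalize List.finRange n = P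
  induction P with
  | nil => simp [expd]
  | cons j P ih =>
    have he : expd b (j :: P) = List.replicate (b j) j ++ expd b P := by simp [expd]
    rw [he]
    simp [ih]

theorem finite_refines (n : ℕ) (w : List ℕ) :
    {b : Fin n → ℕ | Refines (posPart b) (descComp w)}.Finite := by
  apply (Set.finite_Iic (fun _ : Fin n => w.length)).subset
  intro b hb i
  have h := chunks_sum _ _ ((refines_posPart b w).1 hb)
  rw [← h]
  exact List.single_le_sum (by simp) _ (by simp)

theorem finite_SL (n : ℕ) (w : List ℕ) : (SL n w).Finite := by
  rw [← (bij_SL n w).image_eq]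
  exact (finite_refines n w).image _

theorem Fq_eq (n : ℕ) (w : List ℕ) : Fq n (descComp w) = ∑ᶠ L ∈ SL n w, wt L :=
  finsum_mem_eq_of_bijOn _ (bij_SL n w) (fun b hb => wt_zip b w hb)

theorem finite_shuffle (A B : List ℕ) : {C | IsShuffle A B C}.Finite := by
  apply (List.finite_toSet (A ++ B).permutations).subset
  rintro C ⟨h1, h2⟩
  simp only [Set.mem_setOf_eq, List.mem_permutations]
  rw [← h1, ← h2]
  have := List.filter_append_perm (fun x => x % 2 == 1) C
  refine this.symm.trans ?_
  apply List.Perm.of_eq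
  congr 1
  apply List.filter_congr
  intro x _
  rcases Nat.mod_two_eq_zero_or_one x with h | h <;> simp [h]

theorem bij_merge (n : ℕ) (A B : List ℕ) (hA : ∀ x ∈ A, x % 2 = 1) (hB : ∀ x ∈ B, x % 2 = 0) :
    Set.BijOn (fun p : List (Fin n × ℕ) × List (Fin n × ℕ) => (p.1 ++ p.2).insertionSort LexR)
      (SL n A ×ˢ SL n B) (⋃ C ∈ {C | IsShuffle A B C}, SL n C) := by
  let fo : List (Fin n × ℕ) → List (Fin n × ℕ) := List.filter (fun p => p.2 % 2 == 1)
  let fe : List (Fin n × ℕ) → List (Fin n × ℕ) := List.filter (fun p => p.2 % 2 == 0)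
  have mo : ∀ L, (fo L).map Prod.snd = (L.map Prod.snd).filter (fun x => x % 2 == 1) := by
    intro L; rw [List.filter_map]; rfl
  have me : ∀ L, (fe L).map Prod.snd = (L.map Prod.snd).filter (fun x => x % 2 == 0) := by
    intro L; rw [List.filter_map]; rfl
  have ko : ∀ p ∈ SL n A ×ˢ SL n B, fo ((p.1 ++ p.2).insertionSort LexR) = p.1 := by
    rintro ⟨L, M⟩ ⟨⟨hL, rfl⟩, ⟨hM, rfl⟩⟩
    apply List.Perm.eq_of_pairwise' (r := LexR)
      ((List.pairwise_insertionSort LexR _).filter _) hL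
    refine ((List.perm_insertionSort LexR _).filter _).trans (List.Perm.of_eq ?_)
    rw [List.filter_append, List.filter_eq_self.2, List.filter_eq_nil_iff.2, List.append_nil]
    · intro a ha; simp [hB a.2 (List.mem_map_of_mem ha)]
    · intro a ha; simp [hA a.2 (List.mem_map_of_mem ha)]
  have ke : ∀ p ∈ SL n A ×ˢ SL n B, fe ((p.1 ++ p.2).insertionSort LexR) = p.2 := by
    rintro ⟨L, M⟩ ⟨⟨hL, rfl⟩, ⟨hM, rfl⟩⟩
    apply List.Perm.eq_of_pairwise' (r := LexR)
      ((List.pairwise_insertionSort LexR _).filter _) hM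
    refine ((List.perm_insertionSort LexR _).filter _).trans (List.Perm.of_eq ?_)
    rw [List.filter_append, List.filter_eq_nil_iff.2, List.filter_eq_self.2, List.nil_append]
    · intro a ha; simp [hB a.2 (List.mem_map_of_mem ha)]
    · intro a ha; simp [hA a.2 (List.mem_map_of_mem ha)]
  refine ⟨?_, ?_, ?_⟩
  · intro p hp
    simp only [Set.mem_iUnion]
    refine ⟨((p.1 ++ p.2).insertionSort LexR).map Prod.snd, ⟨?_, ?_⟩,
      List.pairwise_insertionSort LexR _, rfl⟩
    · rw [← mo, ko p hp]; exact hp.1.2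
    · rw [← me, ke p hp]; exact hp.2.2
  · intro p hp q hq h
    apply Prod.ext
    · rw [← ko p hp, ← ko q hq]; exact congrArg fo h
    · rw [← ke p hp, ← ke q hq]; exact congrArg fe h
  · intro L hL
    simp only [Set.mem_iUnion] at hL
    obtain ⟨C, ⟨h1, h2⟩, h3, rfl⟩ := hL
    refine ⟨(fo L, fe L), ⟨⟨h3.filter _, by rw [mo, h1]⟩, ⟨h3.filter _, by rw [me, h2]⟩⟩, ?_⟩
    apply List.Perm.eq_of_pairwise' (r := LexR) (List.pairwise_insertionSort LexR _) h3
    refine (List.perm_insertionSort LexR _).trans ?_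
    refine List.Perm.trans (List.Perm.of_eq ?_)
      (List.filter_append_perm (fun p : Fin n × ℕ => p.2 % 2 == 1) L)
    show fo L ++ fe L = _
    congr 1
    apply List.filter_congr
    intro x _
    rcases Nat.mod_two_eq_zero_or_one x.2 with h | h <;> simp [h]

theorem wt_merge {n : ℕ} (L M : List (Fin n × ℕ)) :
    wt L * wt M = wt ((L ++ M).insertionSort LexR) := by
  unfold wt
  rw [← List.prod_append, ← List.map_append]
  exact (((List.perm_insertionSort LexR _).map _).prod_eq).symm

theorem finsum_mul_prod {ι κ R : Type*} [CommRing R] {s : Set ι} {t : Set κ} (hs : s.Finite)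
    (ht : t.Finite) (f : ι → R) (g : κ → R) :
    (∑ᶠ i ∈ s, f i) * (∑ᶠ j ∈ t, g j) = ∑ᶠ p ∈ s ×ˢ t, f p.1 * g p.2 := by
  rw [finsum_mem_eq_finite_toFinset_sum _ hs, finsum_mem_eq_finite_toFinset_sum _ ht,
    finsum_mem_eq_finite_toFinset_sum _ (hs.prod ht), Finset.sum_mul_sum,
    ← Finset.sum_product']
  apply Finset.sum_congr _ (fun _ _ => rfl)
  ext p
  simp

theorem Fq_mul (n : ℕ) (A B : List ℕ) (hA : ∀ x ∈ A, x % 2 = 1) (hB : ∀ x ∈ B, x % 2 = 0) :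
    Fq n (descComp A) * Fq n (descComp B) =
      ∑ᶠ C ∈ {C | IsShuffle A B C}, Fq n (descComp C) := by
  simp only [Fq_eq]
  rw [finsum_mul_prod (finite_SL n A) (finite_SL n B),
    ← finsum_mem_biUnion _ (finite_shuffle A B) (fun C _ => finite_SL n C)]
  · exact finsum_mem_eq_of_bijOn _ (bij_merge n A B hA hB) (fun p _ => wt_merge p.1 p.2)
  · intro C _ D _ hCD
    rw [Function.onFun, Set.disjoint_left]
    rintro L ⟨_, h1⟩ ⟨_, h2⟩
    exact hCD (h1.symm.trans h2)

/-- For strong compositions `α`, `β`, the product of fundamental quasisymmetric polynomials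
is `F_α · F_β = ∑_γ c_{α,β}^γ F_γ`, where `c_{α,β}^γ` is the multiplicity of `γ` in the
shuffle product `α ⧢ β`. -/
theorem fundamental_qsym_mult (n : ℕ) (α β : List ℕ)
    (hα : ∀ x ∈ α, 0 < x) (hβ : ∀ x ∈ β, 0 < x) :
    Fq n α * Fq n β =
      ∑ᶠ (γ : List ℕ) (_ : ∀ x ∈ γ, 0 < x), (shuffleMult α β γ : ℤ) • Fq n γ := by
  classical
  have hm := Fq_mul n (wordA α) (wordB β) (fun x hx => (wordA_mem α x hx).1)
    (fun x hx => (wordB_mem β x hx).1)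
  rw [descComp_wordA α hα, descComp_wordB β hβ] at hm
  rw [hm]
  have hfin := finite_shuffle (wordA α) (wordB β)
  have hmult : ∀ γ, shuffleMult α β γ = (hfin.toFinset.filter (fun C => descComp C = γ)).card := by
    intro γ
    rw [shuffleMult]
    refine Nat.subtype_card _ ?_
    intro C
    simp
  rw [finsum_mem_eq_finite_toFinset_sum _ hfin, Finset.sum_comp (Fq n) descComp]
  rw [finsum_eq_sum_of_support_subset (s := hfin.toFinset.image descComp)]
  · apply Finset.sum_congr rfl
    intro γ hγ
    obtain ⟨C, _, rfl⟩ := Finset.mem_image.1 hγ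
    rw [finsum_eq_if, if_pos (descComp_pos C), hmult]
    simp
  · intro γ hγ
    by_contra hn
    apply hγ
    have h0 : shuffleMult α β γ = 0 := by
      rw [hmult, Finset.card_eq_zero, Finset.filter_eq_empty_iff]
      intro C hC h
      exact hn (Finset.mem_coe.2 (Finset.mem_image.2 ⟨C, hC, h⟩))
    simp [h0]
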